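/- Let f be an (n,m)-function with NL(f) ≥ 2^{n-1} − 2^{n-M-1} where M ≤ n/2. Then any ΣΠΣ circuit with s AND gates computing f gives rise to an m-dimensional linear code in 𝔽₂^s with minimum distance at least M: the vectors v_T ∈ 𝔽₂^s recording which AND gates feed (mod 2) into the output f_T satisfy |v_T| ≥ M for all nonempty T ⊆ [m], and {v_{i} : i ∈ [m]} span an m-dimensional subspace. -/

import Mathlib

/-- Nonlinearity of an `(n,1)`-function: `2^n` minus the maximal agreement
with an affine function `x ↦ ⟨a,x⟩ + b`. -/
noncomputable def NL (n : ℕ) (f : (Fin n → ZMod 2) → ZMod 2) : ℕ :=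
  2 ^ n - Finset.univ.sup (fun ab : (Fin n → ZMod 2) × ZMod 2 =>
    Nat.card {x : Fin n → ZMod 2 | (∑ i, ab.1 i * x i) + ab.2 = f x})

/-- The nontrivial additive character of `ZMod 2`, with values `1` and `-1`. -/
def signChar (b : ZMod 2) : ℤ := if b = 0 then 1 else -1

lemma signChar_add (b c : ZMod 2) : signChar (b + c) = signChar b * signChar c := by
  revert b c; decide

/-- The affine function `x ↦ ⟨ab.1, x⟩ + ab.2`. -/
def affineForm {n : ℕ} (ab : (Fin n → ZMod 2) × ZMod 2) (x : Fin n → ZMod 2) : ZMod 2 :=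
  (∑ p, ab.1 p * x p) + ab.2

lemma affineForm_add {n : ℕ} (ab cd : (Fin n → ZMod 2) × ZMod 2) (x : Fin n → ZMod 2) :
    affineForm (ab + cd) x = affineForm ab x + affineForm cd x := by
  simp only [affineForm, Prod.fst_add, Prod.snd_add, Pi.add_apply, add_mul,
    Finset.sum_add_distrib]
  ring

lemma affineForm_sum {n : ℕ} {ι : Type*} (T : Finset ι) (ab : ι → (Fin n → ZMod 2) × ZMod 2)
    (x : Fin n → ZMod 2) : affineForm (∑ i ∈ T, ab i) x = ∑ i ∈ T, affineForm (ab i) x := by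
  classical
  induction T using Finset.induction_on with
  | empty => simp [affineForm]
  | insert i T hi ih => rw [Finset.sum_insert hi, Finset.sum_insert hi, affineForm_add, ih]

lemma affineForm_const {n : ℕ} (b : ZMod 2) (x : Fin n → ZMod 2) :
    affineForm (0, b) x = b := by
  simp [affineForm]

lemma affineForm_add_add {n : ℕ} (ab : (Fin n → ZMod 2) × ZMod 2) (x y z : Fin n → ZMod 2) :
    affineForm ab (x + y + z) = affineForm ab x + affineForm ab y + affineForm ab z := by
  simp only [affineForm, Pi.add_apply, mul_add, Finset.sum_add_distrib]
  generalize ab.2 = b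
  have h : b + b = 0 := CharTwo.add_self_eq_zero b
  linear_combination -h

/-- An affine function that is not constant on an affine subspace is balanced on it. -/
lemma card_eq_two_mul_card_filter_affineForm {n : ℕ} {W : Finset (Fin n → ZMod 2)}
    (hW : ∀ x ∈ W, ∀ y ∈ W, ∀ z ∈ W, x + y + z ∈ W) (ab : (Fin n → ZMod 2) × ZMod 2)
    {u v : Fin n → ZMod 2} (hu : u ∈ W) (hv : v ∈ W)
    (huv : affineForm ab u ≠ affineForm ab v) :
    W.card = 2 * (W.filter (fun x => affineForm ab x = 0)).card := by
  have huv' : affineForm ab u + affineForm ab v = 1 := by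
    revert huv
    generalize affineForm ab u = b
    generalize affineForm ab v = c
    revert b c; decide
  have hcancel : ∀ x : Fin n → ZMod 2, x + u + v + u + v = x := fun x => by
    rw [show x + u + v + u + v = x + (u + u) + (v + v) by abel]
    have h2 : ∀ y : Fin n → ZMod 2, y + y = 0 := fun y => funext fun p =>
      CharTwo.add_self_eq_zero (y p)
    rw [h2, h2, add_zero, add_zero]
  have hflip : ∀ x, affineForm ab (x + u + v) = affineForm ab x + 1 := fun x => by
    rw [affineForm_add_add, add_assoc, huv']
  have hcard : (W.filter (fun x => affineForm ab x = 0)).card =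
      (W.filter (fun x => ¬ affineForm ab x = 0)).card := by
    refine Finset.card_bij' (fun x _ => x + u + v) (fun x _ => x + u + v) ?_ ?_
      (fun x _ => hcancel x) (fun x _ => hcancel x)
    · intro x hx
      rw [Finset.mem_filter] at hx ⊢
      refine ⟨hW x hx.1 u hu v hv, ?_⟩
      rw [hflip, hx.2]; decide
    · intro x hx
      rw [Finset.mem_filter] at hx ⊢
      refine ⟨hW x hx.1 u hu v hv, ?_⟩
      have h := hx.2
      rw [hflip]
      revert h
      generalize affineForm ab x = b
      revert b; decide
  have := Finset.card_filter_add_card_filter_not (s := W) (fun x => affineForm ab x = 0)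
  omega

/-- On an affine subspace, a sum of `p` products of affine functions has correlation at least
`2 ^ (-p)` with some affine function. -/
lemma exists_affineForm_card_le_sum {n : ℕ} {ι : Type*} (t : ι → ℕ)
    (l : (j : ι) → Fin (t j) → (Fin n → ZMod 2) × ZMod 2) (J : Finset ι) :
    ∀ W : Finset (Fin n → ZMod 2), (∀ x ∈ W, ∀ y ∈ W, ∀ z ∈ W, x + y + z ∈ W) →
      ∃ g : (Fin n → ZMod 2) × ZMod 2, (W.card : ℤ) ≤ 2 ^ J.card *
        ∑ x ∈ W, signChar ((∑ j ∈ J, ∏ k, affineForm (l j k) x) + affineForm g x) := by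
  classical
  induction J using Finset.induction_on with
  | empty =>
    intro W _
    exact ⟨0, by simp [affineForm, signChar]⟩
  | insert j J hj ih =>
    intro W hW
    rw [Finset.card_insert_of_notMem hj]
    by_cases hconst : ∀ k, ∀ u ∈ W, ∀ v ∈ W, affineForm (l j k) u = affineForm (l j k) v
    · obtain ⟨g, hg⟩ := ih W hW
      rcases W.eq_empty_or_nonempty with rfl | ⟨w, hw⟩
      · exact ⟨0, by simp⟩
      refine ⟨g + (0, ∏ k, affineForm (l j k) w), ?_⟩
      have hsum : ∑ x ∈ W, signChar ((∑ i ∈ insert j J, ∏ k, affineForm (l i k) x) +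
            affineForm (g + (0, ∏ k, affineForm (l j k) w)) x) =
          ∑ x ∈ W, signChar ((∑ i ∈ J, ∏ k, affineForm (l i k) x) + affineForm g x) := by
        refine Finset.sum_congr rfl fun x hx => ?_
        rw [Finset.sum_insert hj, affineForm_add, affineForm_const,
          Finset.prod_congr rfl fun k _ => hconst k x hx w hw]
        congr 1
        have h := CharTwo.add_self_eq_zero (∏ k, affineForm (l j k) w)
        linear_combination h
      rw [hsum, pow_succ]
      have : (0 : ℤ) ≤ W.card := by positivity
      linarith
    · push Not at hconst
      obtain ⟨k, u, hu, v, hv, huv⟩ := hconst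
      obtain ⟨g, hg⟩ := ih (W.filter (fun x => affineForm (l j k) x = 0)) (by
        simp only [Finset.mem_filter]
        intro x hx y hy z hz
        exact ⟨hW x hx.1 y hy.1 z hz.1, by
          rw [affineForm_add_add, hx.2, hy.2, hz.2]; simp⟩)
      have hcard := card_eq_two_mul_card_filter_affineForm hW (l j k) hu hv huv
      have hsum : 2 * ∑ x ∈ W.filter (fun x => affineForm (l j k) x = 0),
            signChar ((∑ i ∈ J, ∏ k, affineForm (l i k) x) + affineForm g x) =
          ∑ x ∈ W, signChar ((∑ i ∈ insert j J, ∏ k, affineForm (l i k) x) + affineForm g x) +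
          ∑ x ∈ W, signChar ((∑ i ∈ insert j J, ∏ k, affineForm (l i k) x) +
            affineForm (g + l j k) x) := by
        rw [Finset.sum_filter, Finset.mul_sum, ← Finset.sum_add_distrib]
        refine Finset.sum_congr rfl fun x _ => ?_
        rw [affineForm_add, ← add_assoc, signChar_add _ (affineForm (l j k) x)]
        split_ifs with h
        · rw [Finset.sum_insert hj, Finset.prod_eq_zero (Finset.mem_univ k) h, h]
          simp only [zero_add, signChar, if_true]
          ring
        · rw [show signChar (affineForm (l j k) x) = -1 from if_neg h]
          ring
      have hcard' : (W.card : ℤ) =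
          2 * ((W.filter (fun x => affineForm (l j k) x = 0)).card : ℤ) := by
        exact_mod_cast hcard
      have hle : (W.card : ℤ) ≤ 2 ^ J.card *
          (∑ x ∈ W, signChar ((∑ i ∈ insert j J, ∏ k, affineForm (l i k) x) + affineForm g x) +
          ∑ x ∈ W, signChar ((∑ i ∈ insert j J, ∏ k, affineForm (l i k) x) +
            affineForm (g + l j k) x)) := by
        rw [hcard', ← hsum]
        linarith
      have hpos : (0 : ℤ) < 2 ^ J.card := by positivity
      rcases le_total
        (∑ x ∈ W, signChar ((∑ i ∈ insert j J, ∏ k, affineForm (l i k) x) + affineForm g x))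
        (∑ x ∈ W, signChar ((∑ i ∈ insert j J, ∏ k, affineForm (l i k) x) +
            affineForm (g + l j k) x)) with h | h
      · refine ⟨g + l j k, ?_⟩
        rw [pow_succ]
        nlinarith
      · refine ⟨g, ?_⟩
        rw [pow_succ]
        nlinarith

lemma sum_signChar_add_affineForm {n : ℕ} (F : (Fin n → ZMod 2) → ZMod 2)
    (g : (Fin n → ZMod 2) × ZMod 2) :
    ∑ x, signChar (F x + affineForm g x) =
      2 * (Nat.card {x : Fin n → ZMod 2 | (∑ i, g.1 i * x i) + g.2 = F x} : ℤ) - 2 ^ n := by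
  have hx : ∀ x, signChar (F x + affineForm g x) =
      2 * (if affineForm g x = F x then 1 else 0) - 1 := fun x => by
    generalize F x = b
    generalize affineForm g x = c
    revert b c; decide
  have hcard : Nat.card {x : Fin n → ZMod 2 | (∑ i, g.1 i * x i) + g.2 = F x} =
      (Finset.univ.filter (fun x => affineForm g x = F x)).card := by
    exact Nat.subtype_card _ fun x => Finset.mem_filter_univ x
  rw [hcard, Finset.sum_congr rfl fun x _ => hx x, Finset.sum_sub_distrib, ← Finset.mul_sum,
    Finset.sum_boole]
  simp

/-- A sum of fewer than `M` products of affine functions and an affine function has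
nonlinearity less than `2 ^ (n - 1) - 2 ^ (n - M - 1)`. -/
lemma NL_lt_of_card_lt {n M : ℕ} (hM1 : 1 ≤ M) (hMn : M < n) {ι : Type*} (t : ι → ℕ)
    (l : (j : ι) → Fin (t j) → (Fin n → ZMod 2) × ZMod 2) (J : Finset ι) (hJ : J.card < M)
    (h : (Fin n → ZMod 2) × ZMod 2) :
    NL n (fun x => (∑ j ∈ J, ∏ k, affineForm (l j k) x) + affineForm h x) <
      2 ^ (n - 1) - 2 ^ (n - M - 1) := by
  obtain ⟨g, hg⟩ := exists_affineForm_card_le_sum t l J Finset.univ (by simp)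
  have hsum := sum_signChar_add_affineForm
    (fun x => (∑ j ∈ J, ∏ k, affineForm (l j k) x) + affineForm h x) (g + h)
  have hcancel : ∀ x, (∑ j ∈ J, ∏ k, affineForm (l j k) x) + affineForm h x +
      affineForm (g + h) x = (∑ j ∈ J, ∏ k, affineForm (l j k) x) + affineForm g x := fun x => by
    have h2 := CharTwo.add_self_eq_zero (affineForm h x)
    rw [affineForm_add]
    linear_combination h2
  simp only [hcancel] at hsum
  rw [hsum] at hg
  unfold NL
  have hle := Finset.le_sup (f := fun ab : (Fin n → ZMod 2) × ZMod 2 =>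
    Nat.card {x : Fin n → ZMod 2 | (∑ i, ab.1 i * x i) + ab.2 =
      (∑ j ∈ J, ∏ k, affineForm (l j k) x) + affineForm h x}) (Finset.mem_univ (g + h))
  generalize Finset.univ.sup (fun ab : (Fin n → ZMod 2) × ZMod 2 =>
    Nat.card {x : Fin n → ZMod 2 | (∑ i, ab.1 i * x i) + ab.2 =
      (∑ j ∈ J, ∏ k, affineForm (l j k) x) + affineForm h x}) = A at hle ⊢
  generalize Nat.card {x : Fin n → ZMod 2 | (∑ i, (g + h).1 i * x i) + (g + h).2 =
      (∑ j ∈ J, ∏ k, affineForm (l j k) x) + affineForm h x} = B at hle hg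
  have hcard : ((Finset.univ : Finset (Fin n → ZMod 2)).card : ℤ) = 2 ^ n := by simp
  rw [hcard] at hg
  obtain ⟨q, rfl⟩ : ∃ q, M = q + 1 := ⟨M - 1, by omega⟩
  obtain ⟨r, rfl⟩ : ∃ r, n = q + r + 2 := ⟨n - q - 2, by omega⟩
  have hr : q + r + 2 - (q + 1) - 1 = r := by omega
  have hn : q + r + 2 - 1 = q + r + 1 := by omega
  rw [hr, hn]
  have hlow : (4 * 2 ^ r : ℤ) ≤ 2 * B - 2 ^ (q + r + 2) := by
    have hpos : (0 : ℤ) < 2 ^ (q + r + 2) := by positivity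
    have hBpos : (0 : ℤ) < 2 * B - 2 ^ (q + r + 2) :=
      pos_of_mul_pos_right (hpos.trans_le hg) (by positivity)
    have hpow : (2 : ℤ) ^ J.card ≤ 2 ^ q := pow_le_pow_right₀ (by norm_num) (by omega)
    have h1 := hg.trans (mul_le_mul_of_nonneg_right hpow hBpos.le)
    rw [show (2 : ℤ) ^ (q + r + 2) = 2 ^ q * (4 * 2 ^ r) by ring] at h1 ⊢
    exact le_of_mul_le_mul_left h1 (by positivity)
  have hlow' : 4 * 2 ^ r + 2 ^ (q + r + 2) ≤ 2 * B := by
    zify; linarith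
  have hrpos : 0 < 2 ^ r := by positivity
  have hmono : 2 ^ r < 2 ^ (q + r + 1) := Nat.pow_lt_pow_right (by norm_num) (by omega)
  have hdouble : 2 ^ (q + r + 2) = 2 * 2 ^ (q + r + 1) := by ring
  omega

/-- A combination of circuit outputs is the sum of the gates selected by the corresponding
combination of characteristic vectors. -/
lemma sum_sum_eq_sum_filter {ι κ : Type*} [Fintype κ] [DecidableEq κ] (T : Finset ι)
    (S : ι → Finset κ) (A : κ → ZMod 2) :
    ∑ i ∈ T, ∑ j ∈ S i, A j = ∑ j ∈ Finset.univ.filter (fun j : κ =>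
      (∑ i ∈ T, if j ∈ S i then (1 : ZMod 2) else 0) ≠ 0), A j := by
  have h : ∀ i ∈ T, ∑ j ∈ S i, A j = ∑ j, (if j ∈ S i then (1 : ZMod 2) else 0) * A j :=
    fun i _ => by simp
  rw [Finset.sum_congr rfl h, Finset.sum_comm, Finset.sum_filter]
  refine Finset.sum_congr rfl fun j _ => ?_
  rw [← Finset.sum_mul]
  generalize (∑ i ∈ T, if j ∈ S i then (1 : ZMod 2) else 0) = b
  generalize A j = c
  revert b c; decide

/-- Vectors over `ZMod 2` are linearly independent if no nonempty subfamily sums to zero. -/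
lemma linearIndependent_zmod_two_of_sum_ne_zero {ι V : Type*} [Fintype ι] [AddCommGroup V]
    [Module (ZMod 2) V] (v : ι → V)
    (hv : ∀ T : Finset ι, T.Nonempty → ∑ i ∈ T, v i ≠ 0) : LinearIndependent (ZMod 2) v := by
  classical
  rw [Fintype.linearIndependent_iff]
  intro g hg i
  by_contra hi
  refine hv (Finset.univ.filter (fun i => g i ≠ 0)) ⟨i, by simpa using hi⟩ ?_
  rw [← hg, Finset.sum_filter]
  refine Finset.sum_congr rfl fun j _ => ?_
  have h01 : ∀ b : ZMod 2, b = 0 ∨ b = 1 := by decide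
  rcases h01 (g j) with h | h <;> simp [h]

/-- A SigmaPiSigma circuit with s AND gates computing an (n,m)-function of
nonlinearity at least 2^(n-1) - 2^(n-M-1) exhibits an m-dimensional linear code
in GF(2)^s with distance at least M: each nonzero combination v_T of the
characteristic vectors of the AND-gate sets has Hamming weight at least M, and
the vectors v_i span an m-dimensional subspace. -/
theorem sps_circuit_gives_code (n m s M : ℕ) (hM1 : 1 ≤ M) (hM : 2 * M ≤ n)
    (f : (Fin n → ZMod 2) → Fin m → ZMod 2)
    (t : Fin s → ℕ)
    (a : (j : Fin s) → Fin (t j) → Fin n → ZMod 2)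
    (c : (j : Fin s) → Fin (t j) → ZMod 2)
    (S : Fin m → Finset (Fin s))
    (lin : Fin m → Fin n → ZMod 2) (cst : Fin m → ZMod 2)
    (hcirc : ∀ x i, f x i =
      (∑ j ∈ S i, ∏ l : Fin (t j), ((∑ p, a j l p * x p) + c j l)) +
        ((∑ p, lin i p * x p) + cst i))
    (hNL : ∀ T : Finset (Fin m), T.Nonempty →
      2 ^ (n - 1) - 2 ^ (n - M - 1) ≤ NL n (fun x => ∑ i ∈ T, f x i)) :
    (∀ T : Finset (Fin m), T.Nonempty →
      M ≤ (Finset.univ.filter (fun j : Fin s =>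
        (∑ i ∈ T, if j ∈ S i then (1 : ZMod 2) else 0) ≠ 0)).card) ∧
      Module.finrank (ZMod 2)
        (Submodule.span (ZMod 2)
          (Set.range (fun i : Fin m =>
            fun j : Fin s => if j ∈ S i then (1 : ZMod 2) else 0))) = m := by
  have hdist : ∀ T : Finset (Fin m), T.Nonempty →
      M ≤ (Finset.univ.filter (fun j : Fin s =>
        (∑ i ∈ T, if j ∈ S i then (1 : ZMod 2) else 0) ≠ 0)).card := by
    intro T hT
    by_contra! hlt
    refine absurd (hNL T hT) (not_le.mpr ?_)
    have hfun : (fun x => ∑ i ∈ T, f x i) = fun x =>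
        (∑ j ∈ Finset.univ.filter (fun j : Fin s =>
          (∑ i ∈ T, if j ∈ S i then (1 : ZMod 2) else 0) ≠ 0),
            ∏ k, affineForm (a j k, c j k) x) + affineForm (∑ i ∈ T, (lin i, cst i)) x := by
      funext x
      rw [← sum_sum_eq_sum_filter, affineForm_sum, ← Finset.sum_add_distrib]
      exact Finset.sum_congr rfl fun i _ => hcirc x i
    rw [hfun]
    exact NL_lt_of_card_lt hM1 (by omega) t (fun j k => (a j k, c j k)) _ hlt _
  refine ⟨hdist, ?_⟩
  rw [finrank_span_eq_card (linearIndependent_zmod_two_of_sum_ne_zero _ ?_), Fintype.card_fin]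
  intro T hT h0
  have hM0 := hdist T hT
  rw [Finset.filter_false_of_mem, Finset.card_empty] at hM0
  · omega
  · intro j _
    have := congrFun h0 j
    simpa only [Finset.sum_apply, Pi.zero_apply, not_not] using this
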